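/- Let (f_0,…,f_5) be a rational solution of A_5(α_0,…,α_5) such that for some i ∈ {0,…,5}, f_i, f_{i+1}, f_{i+2}, f_{i+3} have a pole at t=∞ and f_{i+4}, f_{i+5} are holomorphic at t=∞. Then, as |t| → ∞: t·(f_i(t) − t/2) → α_{i+1} − α_{i+3} − 2α_{i+4} − α_{i+5}, t·(f_{i+1}(t) − t/2) → −α_i + α_{i+2} − α_{i+4}, t·(f_{i+2}(t) − t/2) → −α_{i+1} + α_{i+3} + α_{i+5}, t·(f_{i+3}(t) − t/2) → α_i − α_{i+2} + α_{i+4} + 2α_{i+5}, t·f_{i+4}(t) → 2α_{i+4}, and t·f_{i+5}(t) → −2α_{i+5}. In particular f_i, f_{i+1}, f_{i+2}, f_{i+3} have a pole of order one at t=∞ with leading coefficient 1/2. -/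

import Mathlib

open Filter Topology Polynomial

noncomputable section

/-- Evaluation of a complex rational function at a point (junk value where the
reduced denominator vanishes). -/
def evalR (f : RatFunc ℂ) (t : ℂ) : ℂ := RatFunc.eval (RingHom.id ℂ) t f

/-- `f` is defined at `t`: the reduced denominator does not vanish at `t`. -/
def DefinedAt (f : RatFunc ℂ) (t : ℂ) : Prop := Polynomial.eval t (RatFunc.denom f) ≠ 0

/-- `(f 0, …, f 5)` is a rational solution of the `A₅⁽¹⁾` Painlevé system `A₅(α)`:
the two constraints hold identically as rational functions, and the six ODEs hold at
every point where all six components are defined.  (Indices are taken in `Fin 6`,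
i.e. modulo `6`.) -/
def IsA5Solution (α : Fin 6 → ℂ) (f : Fin 6 → RatFunc ℂ) : Prop :=
  f 0 + f 2 + f 4 = RatFunc.X ∧
  f 1 + f 3 + f 5 = RatFunc.X ∧
  ∀ t : ℂ, (∀ j : Fin 6, DefinedAt (f j) t) → ∀ i : Fin 6,
    t / 2 * deriv (evalR (f i)) t =
      evalR (f i) t *
        (evalR (f (i + 1)) t * evalR (f (i + 2)) t
          + evalR (f (i + 1)) t * evalR (f (i + 4)) t
          + evalR (f (i + 3)) t * evalR (f (i + 4)) t
          - evalR (f (i + 2)) t * evalR (f (i + 3)) t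
          - evalR (f (i + 2)) t * evalR (f (i + 5)) t
          - evalR (f (i + 4)) t * evalR (f (i + 5)) t)
      + (1 / 2 - α (i + 2) - α (i + 4)) * evalR (f i) t
      + α i * (evalR (f (i + 2)) t + evalR (f (i + 4)) t)

/-- `f` has a pole at `t = ∞`: `‖f t‖ → ∞` as `‖t‖ → ∞`. -/
def PoleAtInfty (f : RatFunc ℂ) : Prop :=
  Tendsto (fun t => ‖evalR f t‖) (Bornology.cobounded ℂ) atTop

/-- `f` is holomorphic at `t = ∞`: `f` is bounded as `‖t‖ → ∞`. -/
def HoloAtInfty (f : RatFunc ℂ) : Prop :=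
  IsBoundedUnder (· ≤ ·) (Bornology.cobounded ℂ) fun t => ‖evalR f t‖

/-- `f` has a pole at `c ∈ ℂ`: `‖f t‖ → ∞` as `t → c`. -/
def PoleAt (f : RatFunc ℂ) (c : ℂ) : Prop :=
  Tendsto (fun t => ‖evalR f t‖) (𝓝[≠] c) atTop

/-- `f` is regular at `c ∈ ℂ`: it extends continuously to `c`. -/
def RegularAt (f : RatFunc ℂ) (c : ℂ) : Prop :=
  ∃ L : ℂ, Tendsto (fun t => evalR f t) (𝓝[≠] c) (𝓝 L)

/-- `z` is an integer. -/
def IsInt (z : ℂ) : Prop := ∃ n : ℤ, z = (n : ℂ)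

/-- `z` is an even integer. -/
def IsEvenInt (z : ℂ) : Prop := ∃ n : ℤ, z = 2 * (n : ℂ)

/-- A tuple of rational functions has pole configuration of Type A at `t = ∞`. -/
def TypeA (f : Fin 6 → RatFunc ℂ) : Prop :=
  ∃ i : Fin 6,
    (PoleAtInfty (f i) ∧ PoleAtInfty (f (i + 1)) ∧ HoloAtInfty (f (i + 2)) ∧
      HoloAtInfty (f (i + 3)) ∧ HoloAtInfty (f (i + 4)) ∧ HoloAtInfty (f (i + 5))) ∨
    (PoleAtInfty (f i) ∧ PoleAtInfty (f (i + 3)) ∧ HoloAtInfty (f (i + 1)) ∧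
      HoloAtInfty (f (i + 2)) ∧ HoloAtInfty (f (i + 4)) ∧ HoloAtInfty (f (i + 5))) ∨
    (PoleAtInfty (f i) ∧ PoleAtInfty (f (i + 1)) ∧ PoleAtInfty (f (i + 2)) ∧
      PoleAtInfty (f (i + 4)) ∧ HoloAtInfty (f (i + 3)) ∧ HoloAtInfty (f (i + 5)))

/-- A tuple of rational functions has pole configuration of Type B at `t = ∞`. -/
def TypeB (f : Fin 6 → RatFunc ℂ) : Prop :=
  ∃ i : Fin 6,
    PoleAtInfty (f i) ∧ PoleAtInfty (f (i + 1)) ∧ PoleAtInfty (f (i + 2)) ∧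
    PoleAtInfty (f (i + 3)) ∧ HoloAtInfty (f (i + 4)) ∧ HoloAtInfty (f (i + 5))


open Bornology Asymptotics

lemma Polynomial.tendsto_eval_div_pow_cobounded (p : ℂ[X]) {n : ℕ} (h : p.natDegree ≤ n) :
    Tendsto (fun t => p.eval t / t ^ n) (cobounded ℂ) (𝓝 (p.coeff n)) := by
  have h1 : Tendsto (fun t : ℂ => (p.reflect n).eval t⁻¹) (cobounded ℂ)
      (𝓝 ((p.reflect n).eval 0)) :=
    ((p.reflect n).continuous.tendsto 0).comp tendsto_inv₀_cobounded
  rw [← coeff_zero_eq_eval_zero, coeff_reflect, revAt_le (Nat.zero_le _), Nat.sub_zero] at h1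
  refine h1.congr' ?_
  filter_upwards [eventually_ne_cobounded (0 : ℂ)] with t ht
  have := invertibleOfNonzero ht
  have h2 := eval₂_reflect_mul_pow (RingHom.id ℂ) t n p h
  rw [invOf_eq_inv] at h2
  rw [eq_div_iff (pow_ne_zero _ ht)]
  exact h2

lemma Polynomial.eventually_eval_ne_zero_cobounded {p : ℂ[X]} (hp : p ≠ 0) :
    ∀ᶠ t in cobounded ℂ, p.eval t ≠ 0 := by
  have h := (p.tendsto_eval_div_pow_cobounded le_rfl).eventually_ne
    (leadingCoeff_ne_zero.2 hp)
  filter_upwards [h] with t ht h0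
  simp [h0] at ht

lemma Polynomial.tendsto_mul_logDeriv_cobounded {p : ℂ[X]} (hp : p ≠ 0) :
    Tendsto (fun t => t * p.derivative.eval t / p.eval t) (cobounded ℂ) (𝓝 p.natDegree) := by
  have hd : (X * derivative p).natDegree ≤ p.natDegree := by
    rcases eq_or_ne p.natDegree 0 with h0 | h0
    · rw [natDegree_eq_zero] at h0
      obtain ⟨c, rfl⟩ := h0
      simp
    · have h1 := natDegree_derivative_lt h0
      have h2 := natDegree_mul_le (p := (X : ℂ[X])) (q := derivative p)
      rw [natDegree_X] at h2
      omega
  have hc : (X * derivative p).coeff p.natDegree = p.natDegree * p.leadingCoeff := by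
    rcases h : p.natDegree with _ | n
    · simp
    · rw [coeff_X_mul, coeff_derivative, leadingCoeff, h]
      push_cast
      ring
  have h1 := (tendsto_eval_div_pow_cobounded _ hd).div
    (p.tendsto_eval_div_pow_cobounded le_rfl) (leadingCoeff_ne_zero.2 hp)
  rw [hc, coeff_natDegree, mul_div_cancel_right₀ _ (leadingCoeff_ne_zero.2 hp)] at h1
  refine h1.congr' ?_
  filter_upwards [eventually_ne_cobounded (0 : ℂ)] with t ht
  simp [div_div_div_cancel_right₀ (pow_ne_zero p.natDegree ht)]

lemma evalR_eq_div (f : RatFunc ℂ) (t : ℂ) : evalR f t = f.num.eval t / f.denom.eval t := rfl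

lemma eventually_definedAt (f : RatFunc ℂ) : ∀ᶠ t in cobounded ℂ, DefinedAt f t :=
  eventually_eval_ne_zero_cobounded f.denom_ne_zero

lemma exists_tendsto_evalR_div_zpow {f : RatFunc ℂ} (hf : f ≠ 0) :
    ∃ n : ℤ, ∃ c : ℂ, c ≠ 0 ∧ Tendsto (fun t => evalR f t / t ^ n) (cobounded ℂ) (𝓝 c) ∧
      Tendsto (fun t => t * deriv (evalR f) t / evalR f t) (cobounded ℂ) (𝓝 n) := by
  have hn : f.num ≠ 0 := RatFunc.num_ne_zero hf
  have hd := f.denom_ne_zero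
  refine ⟨f.num.natDegree - f.denom.natDegree, f.num.leadingCoeff / f.denom.leadingCoeff,
    div_ne_zero (leadingCoeff_ne_zero.2 hn) (leadingCoeff_ne_zero.2 hd), ?_, ?_⟩
  · refine ((f.num.tendsto_eval_div_pow_cobounded le_rfl).div
      (f.denom.tendsto_eval_div_pow_cobounded le_rfl) (leadingCoeff_ne_zero.2 hd)).congr' ?_
    filter_upwards [eventually_ne_cobounded (0 : ℂ)] with t ht
    simp only [Pi.div_apply, evalR_eq_div, zpow_sub₀ ht, zpow_natCast]
    rw [div_div_div_comm]
  · have h := (tendsto_mul_logDeriv_cobounded hn).sub (tendsto_mul_logDeriv_cobounded hd)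
    push_cast
    refine h.congr' ?_
    filter_upwards [eventually_eval_ne_zero_cobounded hn, eventually_eval_ne_zero_cobounded hd]
      with t h1 h2
    have h3 := (f.num.hasDerivAt t).div (f.denom.hasDerivAt t) h2
    rw [evalR_eq_div, show evalR f = (fun x => f.num.eval x) / fun x => f.denom.eval x from rfl,
      h3.deriv]
    field_simp

lemma tendsto_zpow_cobounded_zero {n : ℤ} (hn : n < 0) :
    Tendsto (fun t : ℂ => t ^ n) (cobounded ℂ) (𝓝 0) := by
  obtain ⟨k, rfl⟩ : ∃ k : ℕ, n = -((k + 1 : ℕ) : ℤ) := ⟨(-n - 1).toNat, by omega⟩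
  have h := (tendsto_inv₀_cobounded (α := ℂ)).pow (k + 1)
  rw [zero_pow k.succ_ne_zero] at h
  refine h.congr fun t => ?_
  rw [zpow_neg, zpow_natCast, inv_pow]

lemma isBigO_zpow_cobounded_one {n : ℤ} (hn : n ≤ 0) :
    (fun t : ℂ => t ^ n) =O[cobounded ℂ] (fun _ => (1 : ℂ)) := by
  rcases hn.lt_or_eq with h | rfl
  · exact (tendsto_zpow_cobounded_zero h).isBigO_one ℂ
  · simpa using isBigO_refl (fun _ : ℂ => (1 : ℂ)) (cobounded ℂ)

lemma PoleAtInfty.ne_zero {f : RatFunc ℂ} (hf : PoleAtInfty f) : f ≠ 0 := by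
  rintro rfl
  have h : Tendsto (fun _ : ℂ => (0 : ℝ)) (cobounded ℂ) atTop := by
    simpa [PoleAtInfty, evalR] using hf
  exact not_tendsto_const_atTop _ _ h

lemma PoleAtInfty.not_isBigO_one {f : RatFunc ℂ} (hf : PoleAtInfty f) :
    ¬ (evalR f =O[cobounded ℂ] fun _ => (1 : ℂ)) := fun h =>
  not_isBoundedUnder_of_tendsto_atTop hf ((isBigO_one_iff ℂ).1 h)

/-- A pole at infinity has order at least one. -/
lemma PoleAtInfty.isBigO_div {f : RatFunc ℂ} (hf : PoleAtInfty f) :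
    (fun t => t / evalR f t) =O[cobounded ℂ] fun _ => (1 : ℂ) := by
  obtain ⟨n, c, hc, h, -⟩ := exists_tendsto_evalR_div_zpow hf.ne_zero
  have hn : 1 ≤ n := by
    by_contra hn
    refine hf.not_isBigO_one ?_
    have h1 := (h.isBigO_one ℂ).mul (isBigO_zpow_cobounded_one (n := n) (by omega))
    refine h1.congr' ?_ (by simp)
    filter_upwards [eventually_ne_cobounded (0 : ℂ)] with t ht
    exact div_mul_cancel₀ _ (zpow_ne_zero _ ht)
  have h1 := ((h.inv₀ hc).isBigO_one ℂ).mul (isBigO_zpow_cobounded_one (n := 1 - n) (by omega))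
  refine h1.congr' ?_ (by simp)
  filter_upwards [eventually_ne_cobounded (0 : ℂ)] with t ht
  have := zpow_ne_zero n ht
  rw [inv_div, zpow_sub₀ ht, zpow_one]
  field_simp

lemma PoleAtInfty.eventually_ne {f : RatFunc ℂ} (hf : PoleAtInfty f) :
    ∀ᶠ t in cobounded ℂ, evalR f t ≠ 0 := by
  filter_upwards [hf.eventually_gt_atTop 0] with t ht
  exact norm_pos_iff.1 ht

lemma isBigO_mul_logDeriv {f : RatFunc ℂ} (hf : f ≠ 0) :
    (fun t => t * deriv (evalR f) t / evalR f t) =O[cobounded ℂ] fun _ => (1 : ℂ) :=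
  let ⟨_, _, _, _, h⟩ := exists_tendsto_evalR_div_zpow hf
  h.isBigO_one ℂ

lemma HoloAtInfty.isBigO_one {f : RatFunc ℂ} (hf : HoloAtInfty f) :
    evalR f =O[cobounded ℂ] fun _ => (1 : ℂ) :=
  (isBigO_one_iff ℂ).2 hf

lemma HoloAtInfty.isBigO_mul_deriv {f : RatFunc ℂ} (hf : HoloAtInfty f) :
    (fun t => t * deriv (evalR f) t) =O[cobounded ℂ] fun _ => (1 : ℂ) := by
  rcases eq_or_ne f 0 with rfl | h0
  · have : evalR 0 = fun _ => 0 := by ext; simp [evalR]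
    simpa only [this, deriv_const, mul_zero] using isBigO_zero (fun _ : ℂ => (1 : ℂ)) (cobounded ℂ)
  refine ((isBigO_mul_logDeriv h0).mul hf.isBigO_one).congr' ?_ (by simp)
  filter_upwards [eventually_eval_ne_zero_cobounded (RatFunc.num_ne_zero h0),
    eventually_definedAt f] with t h1 h2
  exact div_mul_cancel₀ _ (div_ne_zero h1 h2)

/-- A rational function asymptotic to a nonzero multiple of `t` has order one at infinity. -/
lemma tendsto_mul_logDeriv_of_tendsto_div {f : RatFunc ℂ} {b : ℂ} (hb : b ≠ 0)
    (hf : Tendsto (fun t => evalR f t / t) (cobounded ℂ) (𝓝 b)) :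
    Tendsto (fun t => t * deriv (evalR f) t / evalR f t) (cobounded ℂ) (𝓝 1) := by
  have h0 : f ≠ 0 := by
    rintro rfl
    refine hb (tendsto_nhds_unique hf ?_)
    simp [evalR]
  obtain ⟨n, c, hc, h, hl⟩ := exists_tendsto_evalR_div_zpow h0
  suffices n = 1 by simpa [this] using hl
  have hne : ∀ᶠ t in cobounded ℂ, t ≠ 0 := eventually_ne_cobounded (0 : ℂ)
  rcases lt_trichotomy n 1 with hn | hn | hn
  · refine absurd (tendsto_nhds_unique hf ?_) hb
    have h1 := h.mul (tendsto_zpow_cobounded_zero (n := n - 1) (by omega))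
    rw [mul_zero] at h1
    refine h1.congr' ?_
    filter_upwards [hne] with t ht
    have := zpow_ne_zero n ht
    rw [zpow_sub₀ ht, zpow_one]
    field_simp
  · exact hn
  · refine absurd (tendsto_nhds_unique h ?_) hc
    have h1 := hf.mul (tendsto_zpow_cobounded_zero (n := 1 - n) (by omega))
    rw [mul_zero] at h1
    refine h1.congr' ?_
    filter_upwards [hne] with t ht
    have := zpow_ne_zero n ht
    rw [zpow_sub₀ ht, zpow_one]
    field_simp

lemma tendsto_div_of_isBigO_one {u : ℂ → ℂ} (hu : u =O[cobounded ℂ] fun _ => (1 : ℂ)) :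
    Tendsto (fun t => u t / t) (cobounded ℂ) (𝓝 0) := by
  have h := hu.mul_isLittleO ((isLittleO_one_iff ℂ).2 (tendsto_inv₀_cobounded (α := ℂ)))
  simp only [mul_one, ← div_eq_mul_inv] at h
  exact (isLittleO_one_iff ℂ).1 h

lemma IsA5Solution.sum_eq_X {α : Fin 6 → ℂ} {f : Fin 6 → RatFunc ℂ} (h : IsA5Solution α f)
    (i : Fin 6) : f i + f (i + 2) + f (i + 4) = RatFunc.X := by
  obtain ⟨h0, h1, -⟩ := h
  fin_cases i
  · exact h0
  · exact h1
  · exact Eq.trans (show f 2 + f 4 + f 0 = _ by ring) h0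
  · exact Eq.trans (show f 3 + f 5 + f 1 = _ by ring) h1
  · exact Eq.trans (show f 4 + f 0 + f 2 = _ by ring) h0
  · exact Eq.trans (show f 5 + f 1 + f 3 = _ by ring) h1

lemma eventually_evalR_add_add_eq {f g h : RatFunc ℂ} (hs : f + g + h = RatFunc.X) :
    ∀ᶠ t in cobounded ℂ, evalR f t + evalR g t + evalR h t = t := by
  filter_upwards [eventually_definedAt f, eventually_definedAt g, eventually_definedAt h,
    eventually_definedAt (f + g)] with t h1 h2 h3 h4
  have h5 := congrArg (RatFunc.eval (RingHom.id ℂ) t) hs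
  rwa [RatFunc.eval_add _ _ h4 h3, RatFunc.eval_add _ _ h1 h2, RatFunc.eval_X] at h5

/-- Laurent behaviour at infinity, in terms of the four equations of the system that determine
it. -/
lemma tendsto_of_eventually_system {α₀ α₁ α₂ α₃ α₄ α₅ : ℂ} {a b c d e g : RatFunc ℂ}
    (ha : PoleAtInfty a) (hb : PoleAtInfty b) (hc : PoleAtInfty c)
    (he : HoloAtInfty e) (hg : HoloAtInfty g)
    (hs₀ : a + c + e = RatFunc.X) (hs₁ : b + d + g = RatFunc.X)
    (h₀ : ∀ᶠ t in cobounded ℂ, t / 2 * deriv (evalR a) t =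
      evalR a t * (evalR b t * evalR c t + evalR b t * evalR e t + evalR d t * evalR e t
        - evalR c t * evalR d t - evalR c t * evalR g t - evalR e t * evalR g t)
      + (1 / 2 - α₂ - α₄) * evalR a t + α₀ * (evalR c t + evalR e t))
    (h₁ : ∀ᶠ t in cobounded ℂ, t / 2 * deriv (evalR b) t =
      evalR b t * (evalR c t * evalR d t + evalR c t * evalR g t + evalR e t * evalR g t
        - evalR d t * evalR e t - evalR d t * evalR a t - evalR g t * evalR a t)
      + (1 / 2 - α₃ - α₅) * evalR b t + α₁ * (evalR d t + evalR g t))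
    (h₄ : ∀ᶠ t in cobounded ℂ, t / 2 * deriv (evalR e) t =
      evalR e t * (evalR g t * evalR a t + evalR g t * evalR c t + evalR b t * evalR c t
        - evalR a t * evalR b t - evalR a t * evalR d t - evalR c t * evalR d t)
      + (1 / 2 - α₀ - α₂) * evalR e t + α₄ * (evalR a t + evalR c t))
    (h₅ : ∀ᶠ t in cobounded ℂ, t / 2 * deriv (evalR g) t =
      evalR g t * (evalR a t * evalR b t + evalR a t * evalR d t + evalR c t * evalR d t
        - evalR b t * evalR c t - evalR b t * evalR e t - evalR d t * evalR e t)
      + (1 / 2 - α₁ - α₃) * evalR g t + α₅ * (evalR b t + evalR d t)) :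
    Tendsto (fun t => t * (evalR a t - t / 2)) (cobounded ℂ) (𝓝 (α₁ - α₃ - 2 * α₄ - α₅)) ∧
    Tendsto (fun t => t * (evalR b t - t / 2)) (cobounded ℂ) (𝓝 (-α₀ + α₂ - α₄)) ∧
    Tendsto (fun t => t * (evalR c t - t / 2)) (cobounded ℂ) (𝓝 (-α₁ + α₃ + α₅)) ∧
    Tendsto (fun t => t * (evalR d t - t / 2)) (cobounded ℂ) (𝓝 (α₀ - α₂ + α₄ + 2 * α₅)) ∧
    Tendsto (fun t => t * evalR e t) (cobounded ℂ) (𝓝 (2 * α₄)) ∧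
    Tendsto (fun t => t * evalR g t) (cobounded ℂ) (𝓝 (-(2 * α₅))) := by
  have ht : ∀ᶠ t in cobounded ℂ, t ≠ 0 := eventually_ne_cobounded (0 : ℂ)
  have hs₀ := eventually_evalR_add_add_eq hs₀
  have hs₁ := eventually_evalR_add_add_eq hs₁
  have hconst (z : ℂ) : (fun _ : ℂ => z) =O[cobounded ℂ] fun _ => (1 : ℂ) :=
    isBigO_const_const _ one_ne_zero _
  have he1 := he.isBigO_one
  have hg1 := hg.isBigO_one
  have heg : (fun t => evalR e t * evalR g t) =O[cobounded ℂ] fun _ => (1 : ℂ) := by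
    simpa using he1.mul hg1
  have het := tendsto_div_of_isBigO_one he1
  have hgt := tendsto_div_of_isBigO_one hg1
  -- the logarithmic derivatives of `a` and `b`, in terms of the system
  have hP₀ : (fun t => t * deriv (evalR a) t / evalR a t / 2 - (1 / 2 - α₂ - α₄)
      - α₀ * (t / evalR a t - 1)) =ᶠ[cobounded ℂ] fun t =>
      evalR c t * (2 * evalR b t - t) + evalR e t * t - 2 * (evalR e t * evalR g t) := by
    filter_upwards [h₀, ha.eventually_ne, hs₀, hs₁] with t h h1 h2 h3
    have hc : evalR c t + evalR e t = t - evalR a t := by linear_combination h2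
    rw [hc] at h
    rw [show evalR d t = t - evalR b t - evalR g t by linear_combination h3] at h
    field_simp
    linear_combination 2 * h
  have hP₁ : (fun t => t * deriv (evalR b) t / evalR b t / 2 - (1 / 2 - α₃ - α₅)
      - α₁ * (t / evalR b t - 1)) =ᶠ[cobounded ℂ] fun t =>
      (t - evalR b t) * (2 * evalR c t - t) + 2 * (evalR e t * evalR g t) := by
    filter_upwards [h₁, hb.eventually_ne, hs₀, hs₁] with t h h1 h2 h3
    have hc : evalR d t + evalR g t = t - evalR b t := by linear_combination h3
    rw [hc] at h
    rw [show evalR d t = t - evalR b t - evalR g t by linear_combination h3,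
      show evalR a t = t - evalR c t - evalR e t by linear_combination h2] at h
    field_simp
    linear_combination 2 * h
  have hbigO {f : RatFunc ℂ} (hf : PoleAtInfty f) (z w : ℂ) :
      (fun t => t * deriv (evalR f) t / evalR f t / 2 - z - w * (t / evalR f t - 1))
        =O[cobounded ℂ] fun _ => (1 : ℂ) := by
    have h1 := (isBigO_mul_logDeriv hf.ne_zero).const_mul_left (1 / 2)
    have h2 := (hf.isBigO_div.sub (hconst 1)).const_mul_left w
    refine ((h1.sub (hconst z)).sub h2).congr_left fun t => by ring
  -- `b` and `d` are asymptotic to `t / 2`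
  have hbt : Tendsto (fun t => evalR b t / t) (cobounded ℂ) (𝓝 (1 / 2)) := by
    have h1 : (fun t => (2 * evalR b t - t)) =O[cobounded ℂ] fun _ => (1 : ℂ) := by
      have h2 := tendsto_div_of_isBigO_one
        (((hbigO ha _ _).congr' hP₀ EventuallyEq.rfl).add (heg.const_mul_left 2))
      have h3 := hc.isBigO_div.mul ((h2.isBigO_one ℂ).sub he1)
      refine h3.congr' ?_ (by simp)
      filter_upwards [ht, hc.eventually_ne] with t ht0 hc0
      field_simp
      ring
    have h2 := ((tendsto_div_of_isBigO_one h1).const_mul (1 / 2)).add_const (1 / 2)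
    rw [mul_zero, zero_add] at h2
    refine h2.congr' ?_
    filter_upwards [ht] with t ht0
    field_simp
    ring
  have hdt : Tendsto (fun t => evalR d t / t) (cobounded ℂ) (𝓝 (1 / 2)) := by
    have h2 := (hbt.const_sub 1).sub hgt
    rw [show (1 : ℂ) - 1 / 2 - 0 = 1 / 2 by norm_num] at h2
    refine h2.congr' ?_
    filter_upwards [ht, hs₁] with t ht0 hs
    rw [show evalR d t = t - evalR b t - evalR g t by linear_combination hs]
    field_simp
  -- `c` and `a` are asymptotic to `t / 2`
  have hbt' : Tendsto (fun t => t / (t - evalR b t)) (cobounded ℂ) (𝓝 2) := by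
    have h1 := (hbt.const_sub 1).inv₀ (by norm_num)
    rw [show ((1 : ℂ) - 1 / 2)⁻¹ = 2 by norm_num] at h1
    refine h1.congr' ?_
    filter_upwards [ht] with t ht0
    rw [one_sub_div ht0, inv_div]
  have hbne : ∀ᶠ t in cobounded ℂ, t - evalR b t ≠ 0 := by
    filter_upwards [hbt'.eventually_ne two_ne_zero] with t h h0
    simp [h0] at h
  have hct : Tendsto (fun t => evalR c t / t) (cobounded ℂ) (𝓝 (1 / 2)) := by
    have h1 : (fun t => t * (2 * evalR c t - t)) =O[cobounded ℂ] fun _ => (1 : ℂ) := by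
      have h2 := ((hbigO hb _ _).congr' hP₁ EventuallyEq.rfl).sub (heg.const_mul_left 2)
      refine ((hbt'.isBigO_one ℂ).mul h2).congr' ?_ (by simp)
      filter_upwards [hbne] with t h0
      field_simp
      ring
    have h2 := tendsto_div_of_isBigO_one ((tendsto_div_of_isBigO_one h1).isBigO_one ℂ)
    have h3 := (h2.const_mul (1 / 2)).add_const (1 / 2)
    rw [mul_zero, zero_add] at h3
    refine h3.congr' ?_
    filter_upwards [ht] with t ht0
    field_simp
    ring
  have hat : Tendsto (fun t => evalR a t / t) (cobounded ℂ) (𝓝 (1 / 2)) := by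
    have h2 := (hct.const_sub 1).sub het
    rw [show (1 : ℂ) - 1 / 2 - 0 = 1 / 2 by norm_num] at h2
    refine h2.congr' ?_
    filter_upwards [ht, hs₀] with t ht0 hs
    rw [show evalR a t = t - evalR c t - evalR e t by linear_combination hs]
    field_simp
  -- the leading coefficients of `e` and `g`
  have hte : Tendsto (fun t => t * evalR e t) (cobounded ℂ) (𝓝 (2 * α₄)) := by
    have hK := ((((hgt.mul hat).add (hgt.mul hct)).add (hbt.mul hct)).sub (hat.mul hbt)).sub
      (hat.mul hdt) |>.sub (hct.mul hdt)
    have hR := (((tendsto_div_of_isBigO_one he.isBigO_mul_deriv).div_const 2).sub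
      (het.const_mul (1 / 2 - α₀ - α₂))).sub ((hat.add hct).const_mul α₄)
    have hlim := hR.div hK (by norm_num)
    convert hlim.congr' ?_ using 2
    · norm_num
      ring
    filter_upwards [h₄, ht, hK.eventually_ne (b₂ := 0) (by norm_num)] with t h h0 hK0
    rw [Pi.div_apply, div_eq_iff hK0]
    field_simp
    linear_combination 2 * h
  have htg : Tendsto (fun t => t * evalR g t) (cobounded ℂ) (𝓝 (-(2 * α₅))) := by
    have hK := ((((hat.mul hbt).add (hat.mul hdt)).add (hct.mul hdt)).sub (hbt.mul hct)).sub
      (hbt.mul het) |>.sub (hdt.mul het)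
    have hR := (((tendsto_div_of_isBigO_one hg.isBigO_mul_deriv).div_const 2).sub
      (hgt.const_mul (1 / 2 - α₁ - α₃))).sub ((hbt.add hdt).const_mul α₅)
    have hlim := hR.div hK (by norm_num)
    convert hlim.congr' ?_ using 2
    · norm_num
      ring
    filter_upwards [h₅, ht, hK.eventually_ne (b₂ := 0) (by norm_num)] with t h h0 hK0
    rw [Pi.div_apply, div_eq_iff hK0]
    field_simp
    linear_combination 2 * h
  have he0 : Tendsto (evalR e) (cobounded ℂ) (𝓝 0) := by
    refine (tendsto_div_of_isBigO_one (hte.isBigO_one ℂ)).congr' ?_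
    filter_upwards [ht] with t h0
    exact mul_div_cancel_left₀ _ h0
  have heg0 : Tendsto (fun t => 2 * (evalR e t * evalR g t)) (cobounded ℂ) (𝓝 0) := by
    have h1 := hg1.mul_isLittleO ((isLittleO_one_iff ℂ).2 he0)
    simp only [mul_one] at h1
    simpa [mul_comm] using ((isLittleO_one_iff ℂ).1 h1).const_mul 2
  have hlog {f : RatFunc ℂ} (hf : Tendsto (fun t => evalR f t / t) (cobounded ℂ) (𝓝 (1 / 2)))
      (z w : ℂ) : Tendsto (fun t => t * deriv (evalR f) t / evalR f t / 2 - z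
        - w * (t / evalR f t - 1)) (cobounded ℂ) (𝓝 (1 / 2 - z - w)) := by
    have h1 := hf.inv₀ (by norm_num)
    simp only [inv_div] at h1
    convert (((tendsto_mul_logDeriv_of_tendsto_div (by norm_num) hf).div_const 2).sub_const
      z).sub ((h1.sub_const 1).const_mul w) using 2
    norm_num
  have htb : Tendsto (fun t => t * (evalR b t - t / 2)) (cobounded ℂ) (𝓝 (-α₀ + α₂ - α₄)) := by
    have h1 := (((hlog hat _ _).congr' hP₀).sub hte).add heg0
    have h2 := ((hct.inv₀ (by norm_num)).mul h1).div_const 2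
    convert h2.congr' ?_ using 2
    · norm_num
      ring
    filter_upwards [hc.eventually_ne, ht] with t h0 ht0
    field_simp
    ring
  have htc : Tendsto (fun t => t * (evalR c t - t / 2)) (cobounded ℂ) (𝓝 (-α₁ + α₃ + α₅)) := by
    have h1 := ((hlog hbt _ _).congr' hP₁).sub heg0
    have h2 := (hbt'.mul h1).div_const 2
    convert h2.congr' ?_ using 2
    · ring
    filter_upwards [hbne] with t h0
    field_simp
    ring
  refine ⟨?_, htb, htc, ?_, hte, htg⟩
  · convert (htc.neg.sub hte).congr' ?_ using 2
    · ring
    filter_upwards [hs₀] with t h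
    linear_combination -t * h
  · convert (htb.neg.sub htg).congr' ?_ using 2
    · ring
    filter_upwards [hs₁] with t h
    linear_combination -t * h

/-- Laurent behaviour at `t = ∞` for a Type B rational solution. -/
theorem stmt_7 (α : Fin 6 → ℂ) (f : Fin 6 → RatFunc ℂ) (i : Fin 6)
    (hsum : α 0 + α 1 + α 2 + α 3 + α 4 + α 5 = 1)
    (hsol : IsA5Solution α f)
    (hpi : PoleAtInfty (f i)) (hpi1 : PoleAtInfty (f (i + 1)))
    (hpi2 : PoleAtInfty (f (i + 2))) (hpi3 : PoleAtInfty (f (i + 3)))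
    (hh4 : HoloAtInfty (f (i + 4))) (hh5 : HoloAtInfty (f (i + 5))) :
    Tendsto (fun t => t * (evalR (f i) t - t / 2)) (Bornology.cobounded ℂ)
        (𝓝 (α (i + 1) - α (i + 3) - 2 * α (i + 4) - α (i + 5))) ∧
    Tendsto (fun t => t * (evalR (f (i + 1)) t - t / 2)) (Bornology.cobounded ℂ)
        (𝓝 (-α i + α (i + 2) - α (i + 4))) ∧
    Tendsto (fun t => t * (evalR (f (i + 2)) t - t / 2)) (Bornology.cobounded ℂ)
        (𝓝 (-α (i + 1) + α (i + 3) + α (i + 5))) ∧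
    Tendsto (fun t => t * (evalR (f (i + 3)) t - t / 2)) (Bornology.cobounded ℂ)
        (𝓝 (α i - α (i + 2) + α (i + 4) + 2 * α (i + 5))) ∧
    Tendsto (fun t => t * evalR (f (i + 4)) t) (Bornology.cobounded ℂ) (𝓝 (2 * α (i + 4))) ∧
    Tendsto (fun t => t * evalR (f (i + 5)) t) (Bornology.cobounded ℂ) (𝓝 (-(2 * α (i + 5)))) := by
  have hdef : ∀ᶠ t in cobounded ℂ, ∀ j, DefinedAt (f j) t :=
    eventually_all.2 fun j => eventually_definedAt (f j)
  have hode (j : Fin 6) := hdef.mono fun t ht => hsol.2.2 t ht j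
  have h1 := hode (i + 1)
  have h4 := hode (i + 4)
  have h5 := hode (i + 5)
  have hs1 := hsol.sum_eq_X (i + 1)
  simp only [add_assoc, Fin.reduceAdd, add_zero] at h1 h4 h5 hs1
  rw [← add_assoc] at hs1
  refine tendsto_of_eventually_system hpi hpi1 hpi2 hh4 hh5 (hsol.sum_eq_X i) hs1 (hode i)
    ?_ ?_ ?_
  · filter_upwards [h1] with t h
    linear_combination h
  · filter_upwards [h4] with t h
    linear_combination h
  · filter_upwards [h5] with t h
    linear_combination h
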